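/- Let A be an n×n real symmetric matrix, x ∈ ℝ^n, and t > 0 a real number. Let λ_{i_1} > λ_{i_2} > … > λ_{i_l} be exactly those distinct eigenvalues λ of A whose eigenspace ker(A − λI) is not orthogonal to x. Then there exist real numbers μ_1, …, μ_l with μ_1 > λ_{i_1} > μ_2 > λ_{i_2} > … > μ_l > λ_{i_l} such that the multiset of eigenvalues of A + t·x x^T (with multiplicity) is obtained from the multiset of eigenvalues of A by removing one copy of each λ_{i_j} and adding μ_1, …, μ_l. -/

import Mathlib

open Matrix BigOperators Finset

section SecularPolynomial

open Polynomial

/-- The numerator of the secular function `1 - ∑ k, c k / (z - lam k)`. -/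
noncomputable def secularPoly {l : ℕ} (lam c : Fin l → ℝ) : ℝ[X] :=
  ∏ j, (X - C (lam j)) - ∑ k, C (c k) * ∏ j ∈ univ.erase k, (X - C (lam j))

variable {l : ℕ} (lam c : Fin l → ℝ)

theorem degree_secularPoly_correction_lt :
    (∑ k, C (c k) * ∏ j ∈ univ.erase k, (X - C (lam j))).degree < (l : WithBot ℕ) := by
  refine (degree_sum_le _ _).trans_lt ?_
  rw [Nat.cast_withBot, Finset.sup_lt_iff (WithBot.bot_lt_coe l)]
  intro k _
  rw [← smul_eq_C_mul]
  refine (degree_smul_le _ _).trans_lt ?_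
  rw [degree_eq_natDegree (monic_prod_X_sub_C _ _).ne_zero,
    natDegree_finsetProd_X_sub_C_eq_card, card_erase_of_mem (mem_univ k), card_univ,
    Fintype.card_fin]
  rw [Nat.cast_withBot, WithBot.coe_lt_coe]
  exact Nat.pred_lt (Nat.ne_of_gt k.pos)

theorem degree_prod_X_sub_C_fin : (∏ j, (X - C (lam j))).degree = (l : WithBot ℕ) := by
  rw [degree_eq_natDegree (monic_prod_X_sub_C _ _).ne_zero,
    natDegree_finsetProd_X_sub_C_eq_card, card_univ, Fintype.card_fin]

theorem degree_secularPoly : (secularPoly lam c).degree = l := by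
  rw [secularPoly, degree_sub_eq_left_of_degree_lt, degree_prod_X_sub_C_fin]
  rw [degree_prod_X_sub_C_fin]
  exact degree_secularPoly_correction_lt lam c

theorem monic_secularPoly : (secularPoly lam c).Monic := by
  refine (monic_prod_X_sub_C lam univ).sub_of_left ?_
  rw [degree_prod_X_sub_C_fin]
  exact degree_secularPoly_correction_lt lam c

theorem eval_secularPoly_of_forall_ne {z : ℝ} (hz : ∀ k, z ≠ lam k) :
    (secularPoly lam c).eval z = (∏ k, (z - lam k)) * (1 - ∑ k, c k / (z - lam k)) := by
  simp only [secularPoly, eval_sub, eval_finsetSum, eval_mul, eval_C, eval_prod, eval_X]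
  rw [mul_sub, mul_one, mul_sum]
  congr 1
  refine sum_congr rfl fun k _ => ?_
  rw [← mul_prod_erase univ _ (mem_univ k)]
  have := sub_ne_zero.mpr (hz k)
  field_simp

theorem eval_secularPoly_self (k : Fin l) :
    (secularPoly lam c).eval (lam k) = -(c k * ∏ j ∈ univ.erase k, (lam k - lam j)) := by
  simp only [secularPoly, eval_sub, eval_finsetSum, eval_mul, eval_C, eval_prod, eval_X]
  rw [prod_eq_zero (mem_univ k) (sub_self _), zero_sub, sum_eq_single k]
  · intro i _ hi
    rw [prod_eq_zero (mem_erase.mpr ⟨hi.symm, mem_univ k⟩) (sub_self _), mul_zero]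
  · simp

variable {lam c}

theorem neg_one_pow_mul_prod_erase_sub_pos (hlam : StrictAnti lam) (k : Fin l) :
    0 < (-1 : ℝ) ^ (k : ℕ) * ∏ j ∈ univ.erase k, (lam k - lam j) := by
  have hsign : (-1 : ℝ) ^ (k : ℕ) = ∏ j ∈ univ.erase k, if j < k then (-1 : ℝ) else 1 := by
    rw [← prod_filter, prod_const]
    congr 1
    rw [← Fin.card_Iio k]
    congr 1
    ext j
    simp only [mem_Iio, mem_filter, mem_erase, mem_univ, and_true]
    exact ⟨fun h => ⟨h.ne, h⟩, fun h => h.2⟩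
  rw [hsign, ← prod_mul_distrib]
  refine prod_pos fun j hj => ?_
  split_ifs with h
  · linarith [hlam h]
  · have : k < j := lt_of_le_of_ne (not_lt.mp h) (mem_erase.mp hj).1.symm
    linarith [hlam this]

theorem neg_one_pow_mul_eval_secularPoly_neg (hlam : StrictAnti lam) (hc : ∀ k, 0 < c k)
    (k : Fin l) : (-1 : ℝ) ^ (k : ℕ) * (secularPoly lam c).eval (lam k) < 0 := by
  rw [eval_secularPoly_self]
  have := mul_pos (hc k) (neg_one_pow_mul_prod_erase_sub_pos hlam k)
  linarith

theorem exists_neg_one_pow_mul_eval_secularPoly_pos (hlam : StrictAnti lam)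
    (hc : ∀ k, 0 < c k) (k : Fin l) :
    ∃ b, lam k < b ∧ (∀ i : Fin l, (i : ℕ) + 1 = k → b = lam i) ∧
      0 < (-1 : ℝ) ^ (k : ℕ) * (secularPoly lam c).eval b := by
  obtain ⟨k, hk⟩ := k
  cases k with
  | zero =>
    have htop := (secularPoly lam c).tendsto_atTop_of_leadingCoeff_nonneg
      (by rw [degree_secularPoly]; exact_mod_cast hk)
      (by rw [(monic_secularPoly lam c).leadingCoeff]; exact zero_le_one)
    obtain ⟨b, hb, hpos⟩ :=
      ((Filter.eventually_gt_atTop (lam ⟨0, hk⟩)).and (htop.eventually_gt_atTop 0)).exists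
    exact ⟨b, hb, fun i hi => absurd hi (by simp), by simpa using hpos⟩
  | succ m =>
    refine ⟨lam ⟨m, by omega⟩, hlam (by simp), fun i hi => ?_, ?_⟩
    · congr 1
      ext
      simpa using hi.symm
    · have := neg_one_pow_mul_eval_secularPoly_neg hlam hc ⟨m, by omega⟩
      simp only [pow_succ] at this ⊢
      linarith

theorem exists_interlacing_roots_secularPoly (hlam : StrictAnti lam) (hc : ∀ k, 0 < c k) :
    ∃ mu : Fin l → ℝ, (∀ k, lam k < mu k) ∧
      (∀ k : Fin l, ∀ h : (k : ℕ) + 1 < l, mu ⟨(k : ℕ) + 1, h⟩ < lam k) ∧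
      secularPoly lam c = ∏ k, (X - C (mu k)) := by
  have hroot : ∀ k : Fin l, ∃ m, lam k < m ∧ (∀ i : Fin l, (i : ℕ) + 1 = k → m < lam i) ∧
      (secularPoly lam c).eval m = 0 := by
    intro k
    obtain ⟨b, hb, hbi, hpos⟩ := exists_neg_one_pow_mul_eval_secularPoly_pos hlam hc k
    obtain ⟨m, hm, hm0⟩ := intermediate_value_Ioo hb.le
      (f := fun z => (-1 : ℝ) ^ (k : ℕ) * (secularPoly lam c).eval z)
      (by fun_prop) ⟨neg_one_pow_mul_eval_secularPoly_neg hlam hc k, hpos⟩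
    exact ⟨m, hm.1, fun i hi => hbi i hi ▸ hm.2, by simpa using hm0⟩
  choose mu hlt hgt hzero using hroot
  have hanti : StrictAnti mu := by
    intro i j hij
    have hj : (j : ℕ) - 1 + 1 = j := Nat.sub_add_cancel (by have : (i : ℕ) < j := hij; omega)
    have h1 := hgt j ⟨(j : ℕ) - 1, by omega⟩ hj
    have h2 : lam ⟨(j : ℕ) - 1, by omega⟩ ≤ lam i :=
      hlam.antitone (Fin.le_def.mpr (Nat.le_sub_one_of_lt hij))
    exact h1.trans_le (h2.trans (hlt i).le)
  refine ⟨mu, hlt, fun k h => hgt _ k rfl, ?_⟩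
  refine eq_of_degree_le_of_eval_index_eq univ hanti.injective.injOn ?_ ?_ ?_ ?_
  · rw [degree_secularPoly, card_univ, Fintype.card_fin]
  · rw [degree_secularPoly, degree_prod_X_sub_C_fin]
  · rw [(monic_secularPoly lam c).leadingCoeff, (monic_prod_X_sub_C mu univ).leadingCoeff]
  · intro k _
    rw [hzero, eval_prod, prod_eq_zero (mem_univ k) (by simp)]

end SecularPolynomial

section RankOne

theorem Matrix.det_one_sub_vecMulVec {ι R : Type*} [Fintype ι] [DecidableEq ι] [CommRing R]
    (u v : ι → R) : (1 - vecMulVec u v).det = 1 - v ⬝ᵥ u := by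
  have h := det_one_add_replicateCol_mul_replicateRow (ι := Unit) (-u) v
  rwa [← vecMulVec_eq, neg_vecMulVec, ← sub_eq_add_neg, dotProduct_neg, ← sub_eq_add_neg] at h

variable {ι κ : Type*} [Fintype ι] [Fintype κ] {A : Matrix ι ι ℝ}

theorem Matrix.IsSymm.dotProduct_eq_zero_of_mulVec_eq_smul (hA : A.IsSymm) {a b : ℝ}
    (hab : a ≠ b) {v w : ι → ℝ} (hv : A *ᵥ v = a • v) (hw : A *ᵥ w = b • w) : v ⬝ᵥ w = 0 := by
  have h : (A *ᵥ v) ⬝ᵥ w = v ⬝ᵥ (A *ᵥ w) := by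
    rw [dotProduct_mulVec, ← mulVec_transpose, hA.eq]
  rw [hv, hw, smul_dotProduct, dotProduct_smul, smul_eq_mul, smul_eq_mul] at h
  exact (mul_eq_zero.mp (by rw [sub_mul, h, sub_self] : (a - b) * (v ⬝ᵥ w) = 0)).resolve_left
    (sub_ne_zero.mpr hab)

/-- A vector is the sum of its components in the eigenspaces which are not orthogonal to it. -/
theorem Matrix.IsSymm.exists_sum_eigenvectors [DecidableEq ι] (hA : A.IsSymm) {lam : κ → ℝ}
    (hlam : Function.Injective lam) (x : ι → ℝ)
    (hx : ∀ (a : ℝ) (v : ι → ℝ), A *ᵥ v = a • v → v ⬝ᵥ x ≠ 0 → a ∈ Set.range lam) :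
    ∃ p : κ → ι → ℝ, (∀ k, A *ᵥ p k = lam k • p k) ∧ ∑ k, p k = x := by
  classical
  have hH : A.IsHermitian := by rwa [IsHermitian, conjTranspose_eq_transpose_of_trivial]
  set u : ι → ι → ℝ := fun i => ⇑(hH.eigenvectorBasis i) with hu
  have hAu : ∀ i, A *ᵥ u i = hH.eigenvalues i • u i := hH.mulVec_eigenvectorBasis
  have hsum : ∑ i, (u i ⬝ᵥ x) • u i = x := by
    have h := hH.eigenvectorBasis.sum_repr (WithLp.toLp 2 x)
    have h' := congrArg (WithLp.ofLp) h
    simp only [WithLp.ofLp_sum, WithLp.ofLp_smul] at h'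
    rw [← h']
    refine sum_congr rfl fun i _ => ?_
    congr 1
    rw [OrthonormalBasis.repr_apply_apply, EuclideanSpace.inner_eq_star_dotProduct,
      dotProduct_comm]
    simp [hu, h']
  refine ⟨fun k => ∑ i with hH.eigenvalues i = lam k, (u i ⬝ᵥ x) • u i, fun k => ?_, ?_⟩
  · rw [mulVec_sum, smul_sum]
    refine sum_congr rfl fun i hi => ?_
    rw [mulVec_smul, hAu, (mem_filter.mp hi).2, smul_comm]
  · nth_rewrite 2 [← hsum]
    simp_rw [sum_filter]
    rw [sum_comm]
    refine sum_congr rfl fun i _ => ?_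
    by_cases hi : u i ⬝ᵥ x = 0
    · simp [hi]
    · obtain ⟨k, hk⟩ := hx _ _ (hAu i) hi
      rw [← hk]
      simp [hlam.eq_iff]

theorem Matrix.det_sub_vecMulVec_mul_eq [DecidableEq ι] {B : Matrix ι ι ℝ} {w x : ι → ℝ}
    (hw : B *ᵥ w = x) (t : ℝ) :
    (B - t • vecMulVec x x).det = B.det * (1 - t * (x ⬝ᵥ w)) := by
  have h : B - t • vecMulVec x x = B * (1 - vecMulVec (t • w) x) := by
    rw [mul_sub, mul_one, mul_vecMulVec, mulVec_smul, hw, smul_vecMulVec]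
  rw [h, det_mul, det_one_sub_vecMulVec, dotProduct_smul, smul_eq_mul]

open Polynomial in
theorem Matrix.charpoly_add_smul_vecMulVec_mul_prod [DecidableEq ι] {l : ℕ}
    (hA : A.IsSymm) {lam : Fin l → ℝ} (hlam : Function.Injective lam) (t : ℝ)
    {p : Fin l → ι → ℝ} (hp : ∀ k, A *ᵥ p k = lam k • p k) {x : ι → ℝ} (hx : ∑ k, p k = x) :
    (A + t • vecMulVec x x).charpoly * ∏ k, (X - C (lam k)) =
      A.charpoly * secularPoly lam (fun k => t * (p k ⬝ᵥ p k)) := by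
  refine eq_of_infinite_eval_eq _ _ ((Set.finite_range lam).infinite_compl.mono fun z hz => ?_)
  have hz : ∀ k, z ≠ lam k := fun k hk => hz ⟨k, hk.symm⟩
  have hxp : ∀ k, x ⬝ᵥ p k = p k ⬝ᵥ p k := by
    intro k
    rw [← hx, sum_dotProduct, sum_eq_single k]
    · intro j _ hj
      exact hA.dotProduct_eq_zero_of_mulVec_eq_smul (hlam.ne hj) (hp j) (hp k)
    · simp
  have hw : (scalar ι z - A) *ᵥ (∑ k, (z - lam k)⁻¹ • p k) = x := by
    rw [mulVec_sum, ← hx]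
    refine sum_congr rfl fun k _ => ?_
    rw [mulVec_smul, sub_mulVec, hp, scalar_apply, ← smul_one_eq_diagonal, smul_mulVec,
      one_mulVec, ← sub_smul, smul_smul, inv_mul_cancel₀ (sub_ne_zero.mpr (hz k)), one_smul]
  have hdet := det_sub_vecMulVec_mul_eq hw t
  simp only [Set.mem_ofPred_eq, eval_mul, eval_secularPoly_of_forall_ne _ _ hz, eval_prod,
    eval_sub, eval_X, eval_C, Matrix.eval_charpoly]
  rw [← sub_sub, hdet, dotProduct_sum, mul_sum]
  have : ∀ k, t * (x ⬝ᵥ (z - lam k)⁻¹ • p k) = t * (p k ⬝ᵥ p k) / (z - lam k) := fun k => by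
    rw [dotProduct_smul, hxp, smul_eq_mul, div_eq_mul_inv]
    ring
  simp_rw [this]
  ring

end RankOne

/-- **Theorem on rank-one perturbation, `t > 0`.** Let `A` be a real
symmetric matrix, `x` a vector, `t > 0`.  Let `lam 0 > lam 1 > … > lam (l-1)` enumerate
exactly those distinct eigenvalues of `A` whose eigenspace is not orthogonal to `x`.
Then there are reals `mu k` with `mu 0 > lam 0 > mu 1 > lam 1 > … > mu (l-1) > lam (l-1)`
such that the multiset of eigenvalues of `A + t • x xᵀ` is obtained from that of `A` by
removing one copy of each `lam k` and adding the `mu k` (stated as an equality of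
multisets of roots of the characteristic polynomials). -/
theorem spectrum_rank_one_perturbation_pos {n l : ℕ}
    (A : Matrix (Fin n) (Fin n) ℝ) (hA : A.IsSymm)
    (x : Fin n → ℝ) (t : ℝ) (ht : 0 < t)
    (lam : Fin l → ℝ) (hlam : StrictAnti lam)
    (hexact : ∀ μ : ℝ,
      (∃ v : Fin n → ℝ, A.mulVec v = μ • v ∧ v ⬝ᵥ x ≠ 0) ↔ μ ∈ Set.range lam) :
    ∃ mu : Fin l → ℝ,
      (∀ k : Fin l, lam k < mu k) ∧
      (∀ k : Fin l, ∀ h : (k : ℕ) + 1 < l, mu ⟨(k : ℕ) + 1, h⟩ < lam k) ∧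
      (A + t • Matrix.vecMulVec x x).charpoly.roots + Multiset.map lam Finset.univ.val
        = A.charpoly.roots + Multiset.map mu Finset.univ.val := by
  have hinj := hlam.injective
  obtain ⟨p, hp, hx⟩ := hA.exists_sum_eigenvectors hinj x
    fun a v hv hvx => (hexact a).mp ⟨v, hv, hvx⟩
  have hp0 : ∀ k, p k ≠ 0 := by
    intro k hk
    obtain ⟨v, hv, hvx⟩ := (hexact (lam k)).mpr ⟨k, rfl⟩
    refine hvx ?_
    rw [← hx, dotProduct_sum]
    refine sum_eq_zero fun j _ => ?_
    rcases eq_or_ne j k with rfl | hj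
    · rw [hk, dotProduct_zero]
    · exact hA.dotProduct_eq_zero_of_mulVec_eq_smul (hinj.ne hj.symm) hv (hp j)
  have hpos : ∀ k, 0 < t * (p k ⬝ᵥ p k) := fun k =>
    mul_pos ht (lt_of_le_of_ne (sum_nonneg fun i _ => mul_self_nonneg _)
      (Ne.symm (dotProduct_self_eq_zero.not.mpr (hp0 k))))
  obtain ⟨mu, hlt, hgt, hmu⟩ := exists_interlacing_roots_secularPoly hlam hpos
  refine ⟨mu, hlt, hgt, ?_⟩
  have hroots : ∀ f : Fin l → ℝ,
      (∏ k, (Polynomial.X - Polynomial.C (f k))).roots = Multiset.map f univ.val := fun f => by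
    rw [← Polynomial.roots_multiset_prod_X_sub_C (Multiset.map f univ.val), Multiset.map_map]
    rfl
  have hchar := Matrix.charpoly_add_smul_vecMulVec_mul_prod hA hinj t hp hx
  rw [hmu] at hchar
  have h := congrArg Polynomial.roots hchar
  rwa [Polynomial.roots_mul, Polynomial.roots_mul, hroots, hroots] at h
  · exact ((Matrix.charpoly_monic _).mul (Polynomial.monic_prod_X_sub_C _ _)).ne_zero
  · exact ((Matrix.charpoly_monic _).mul (Polynomial.monic_prod_X_sub_C _ _)).ne_zero
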